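/- arXiv:2510.17515 — 3 statements merged into one kernel-verified Lean document; each statement's English description precedes it below -/
import Mathlib

section
/- Let L ≥ 1 and c > 0. Let Φ : ℝ³ → ℝ³ be positively 1-homogeneous (Φ(τ • v) = τ • Φ(v) for all τ ≥ 0) and let Φ̇ : ℝ³ → ℝ be positively 0-homogeneous (Φ̇(τ • v) = Φ̇(v) for all τ > 0). Fix k₀ ∈ ℝ³ and κ₀ ∈ ℝ, and let π : ℝ³ → ℝ denote projection onto the second coordinate. For a parameter a ∈ {c, 1}, define t_a(1) := a • k₀, s_a(l) := Φ(t_a(l)), ṡ_a(l) := Φ̇(t_a(l)), t_a(l+1) := a • s_a(l) for l ≥ 1, and set s̄_a(0) := κ₀ and s̄_a(l) := π(s_a(l)) for l ≥ 1. Define Θ_c := ∑_{l=1}^{L} c^{L+1-l} · s̄_c(l−1) · ∏_{m=l}^{L} ṡ_c(m) and Θ_std := ∑_{l=1}^{L} s̄_1(l−1) · ∏_{m=l}^{L} ṡ_1(m). Then Θ_c = c^L · Θ_std. -/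
/-- Constant-graphon NTK scaling (Section 5.3 / Appendix B): when all layer
graphons are the constant `c > 0`, the Graphon NTK equals `c ^ L` times the
standard NTK of the fully connected network with `L` hidden layers.
Here `t a l` is the triple of pre-activation covariances at layer `l`, `Φ` is the
(positively 1-homogeneous) ReLU dual-activation map on covariance triples, `Φ̇` is
the (positively 0-homogeneous) derivative dual-activation map, `π` is projection
onto the second coordinate, and `κ₀` is the input Gram value. -/
theorem constant_graphon_ntk_scaling
    (L : ℕ) (hL : 1 ≤ L) (c : ℝ) (hc : 0 < c)
    (Φ : (Fin 3 → ℝ) → (Fin 3 → ℝ))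
    (hΦ : ∀ τ : ℝ, 0 ≤ τ → ∀ v : Fin 3 → ℝ, Φ (τ • v) = τ • Φ v)
    (Φdot : (Fin 3 → ℝ) → ℝ)
    (hΦdot : ∀ τ : ℝ, 0 < τ → ∀ v : Fin 3 → ℝ, Φdot (τ • v) = Φdot v)
    (k₀ : Fin 3 → ℝ) (κ₀ : ℝ)
    (tc t1 sc s1 : ℕ → Fin 3 → ℝ) (sdc sd1 sbc sb1 : ℕ → ℝ)
    (htc1 : tc 1 = c • k₀) (ht11 : t1 1 = (1 : ℝ) • k₀)
    (hsc : ∀ l, 1 ≤ l → sc l = Φ (tc l)) (hs1 : ∀ l, 1 ≤ l → s1 l = Φ (t1 l))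
    (hsdc : ∀ l, 1 ≤ l → sdc l = Φdot (tc l)) (hsd1 : ∀ l, 1 ≤ l → sd1 l = Φdot (t1 l))
    (htc : ∀ l, 1 ≤ l → tc (l + 1) = c • sc l)
    (ht1 : ∀ l, 1 ≤ l → t1 (l + 1) = (1 : ℝ) • s1 l)
    (hsbc0 : sbc 0 = κ₀) (hsb10 : sb1 0 = κ₀)
    (hsbc : ∀ l, 1 ≤ l → sbc l = sc l 1) (hsb1 : ∀ l, 1 ≤ l → sb1 l = s1 l 1)
    (Θc Θstd : ℝ)
    (hΘc : Θc = ∑ l ∈ Finset.Icc 1 L,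
      c ^ (L + 1 - l) * sbc (l - 1) * ∏ m ∈ Finset.Icc l L, sdc m)
    (hΘstd : Θstd = ∑ l ∈ Finset.Icc 1 L,
      sb1 (l - 1) * ∏ m ∈ Finset.Icc l L, sd1 m) :
    Θc = c ^ L * Θstd := by
  have ht : ∀ l, 1 ≤ l → tc l = c ^ l • t1 l := by
    intro l hl
    induction l, hl using Nat.le_induction with
    | base => rw [htc1, ht11, one_smul, pow_one]
    | succ n hn ih =>
      rw [htc n hn, ht1 n hn, hsc n hn, hs1 n hn, ih, hΦ _ (pow_pos hc n).le, one_smul,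
        smul_smul, pow_succ, mul_comm]
  have hsd : ∀ l, 1 ≤ l → sdc l = sd1 l := by
    intro l hl
    rw [hsdc l hl, hsd1 l hl, ht l hl, hΦdot _ (pow_pos hc l)]
  have hsb : ∀ l, sbc l = c ^ l * sb1 l := by
    intro l
    rcases Nat.eq_zero_or_pos l with h | h
    · subst h
      rw [hsbc0, hsb10, pow_zero, one_mul]
    · rw [hsbc l h, hsb1 l h, hsc l h, hs1 l h, ht l h, hΦ _ (pow_pos hc l).le,
        Pi.smul_apply, smul_eq_mul]
  rw [hΘc, hΘstd, Finset.mul_sum]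
  refine Finset.sum_congr rfl fun l hl => ?_
  obtain ⟨h1, h2⟩ := Finset.mem_Icc.mp hl
  have hp : ∏ m ∈ Finset.Icc l L, sdc m = ∏ m ∈ Finset.Icc l L, sd1 m :=
    Finset.prod_congr rfl fun m hm => hsd m (h1.trans (Finset.mem_Icc.mp hm).1)
  have he : c ^ L = c ^ (L + 1 - l) * c ^ (l - 1) := by
    rw [← pow_add]
    congr 1
    omega
  rw [hp, hsb, he]
  ring
end

section
/- Let H > 0. For each n ≥ 1 and each j ∈ Fin n, let W_{n,j} be a real random variable with law gaussianReal 0 (v_{n,j}) where 0 ≤ v_{n,j} ≤ 1, and let h_{n,j} be a real random variable with |h_{n,j}| ≤ H almost surely such that W_{n,j} and h_{n,j} are independent. Then for every ε > 0, lim_{n → ∞} (1/n) · ∑_{j ∈ Fin n} E[(W_{n,j} · h_{n,j})² · 1{ |W_{n,j} · h_{n,j}| > ε √n }] = 0. -/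
open MeasureTheory ProbabilityTheory Filter

theorem gaussian_fourth (v : NNReal) (hv : v ≤ 1) :
    Integrable (fun x : ℝ => x ^ 4) (gaussianReal 0 v) ∧
    ∫ x, x ^ 4 ∂(gaussianReal 0 v) ≤ ∫ x, x ^ 4 ∂(gaussianReal 0 1) := by
  have hint : ∀ w : NNReal, Integrable (fun x : ℝ => x ^ 4) (gaussianReal 0 w) := by
    intro w
    have h1 := (memLp_id_gaussianReal (μ := 0) (v := w) 4).integrable_norm_pow
      (p := 4) (by norm_num)
    refine h1.congr (Eventually.of_forall fun x => ?_)
    simp only [id, Real.norm_eq_abs]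
    exact Even.pow_abs (by decide) x
  refine ⟨hint v, ?_⟩
  have hmap : gaussianReal 0 v = (gaussianReal 0 1).map (fun x => Real.sqrt v * x) := by
    rw [gaussianReal_map_const_mul]
    congr 1
    · simp
    · ext
      simp
  rw [hmap, integral_map (by fun_prop) (by fun_prop)]
  refine integral_mono_of_nonneg (Eventually.of_forall fun x => by positivity) (hint 1)
    (Eventually.of_forall fun x => ?_)
  have h1 : Real.sqrt v ^ 4 ≤ 1 :=
    pow_le_one₀ (Real.sqrt_nonneg _) (Real.sqrt_le_one.2 (by exact_mod_cast hv))
  have h2 : 0 ≤ x ^ 4 := by positivity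
  simp only [mul_pow]
  nlinarith

theorem term_bound {Ω : Type*} [MeasurableSpace Ω] (P : Measure Ω)
    (H a : ℝ) (ha : 0 < a) (v : NNReal) (hv : v ≤ 1)
    (W h : Ω → ℝ) (hW : Measurable W) (hlaw : Measure.map W P = gaussianReal 0 v)
    (hh : Measurable h) (hb : ∀ᵐ ω ∂P, |h ω| ≤ H) :
    ∫ ω in {ω | a < |W ω * h ω|}, (W ω * h ω) ^ 2 ∂P
      ≤ H ^ 4 / a ^ 2 * ∫ x, x ^ 4 ∂(gaussianReal 0 1) := by
  obtain ⟨h1, h2⟩ := gaussian_fourth v hv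
  rw [← hlaw] at h1 h2
  rw [integral_map hW.aemeasurable (by fun_prop)] at h2
  have h3 : Integrable (fun ω => W ω ^ 4) P := h1.comp_measurable hW
  have hS : MeasurableSet {ω | a < |W ω * h ω|} :=
    measurableSet_lt measurable_const (by fun_prop)
  rw [← integral_indicator hS]
  calc _ ≤ ∫ ω, H ^ 4 / a ^ 2 * W ω ^ 4 ∂P := by
        refine integral_mono_of_nonneg (Eventually.of_forall fun x => ?_) (h3.const_mul _) ?_
        · exact Set.indicator_nonneg (fun _ _ => by positivity) x
        · filter_upwards [hb] with ω hω
          by_cases hm : ω ∈ {ω | a < |W ω * h ω|}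
          · rw [Set.indicator_of_mem hm]
            have hm' : a < |W ω * h ω| := hm
            have e1 : a ^ 2 ≤ (W ω * h ω) ^ 2 := by
              rw [← sq_abs (W ω * h ω)]
              gcongr
            have e2 : h ω ^ 4 ≤ H ^ 4 := by
              rw [← Even.pow_abs (by decide : Even 4) (h ω)]
              gcongr
            rw [div_mul_eq_mul_div, le_div_iff₀ (by positivity)]
            calc (W ω * h ω) ^ 2 * a ^ 2 ≤ (W ω * h ω) ^ 2 * (W ω * h ω) ^ 2 := by gcongr
              _ = h ω ^ 4 * W ω ^ 4 := by ring
              _ ≤ _ := by gcongr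
          · rw [Set.indicator_of_notMem hm]
            positivity
    _ = H ^ 4 / a ^ 2 * ∫ ω, W ω ^ 4 ∂P := integral_const_mul _ _
    _ ≤ _ := by gcongr

/-- Verification of the Lindeberg condition for graphon-structured networks
(Appendix A): with weight variances bounded by 1 (by the graphon), activations
bounded by `H`, each weight independent of the corresponding activation, and the
`1/√n` scaling, the truncated second moments are asymptotically negligible. -/
theorem lindeberg_condition_graphon
    {Ω : Type*} [MeasurableSpace Ω] (P : Measure Ω) [IsProbabilityMeasure P]
    (H : ℝ) (hH : 0 < H)
    (v : (n : ℕ) → Fin n → NNReal) (hv : ∀ n (j : Fin n), v n j ≤ 1)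
    (W : (n : ℕ) → Fin n → Ω → ℝ) (hWmeas : ∀ n (j : Fin n), Measurable (W n j))
    (hWlaw : ∀ n (j : Fin n), Measure.map (W n j) P = gaussianReal 0 (v n j))
    (h : (n : ℕ) → Fin n → Ω → ℝ) (hhmeas : ∀ n (j : Fin n), Measurable (h n j))
    (hhbdd : ∀ n (j : Fin n), ∀ᵐ ω ∂P, |h n j ω| ≤ H)
    (hindep : ∀ n (j : Fin n), IndepFun (W n j) (h n j) P) :
    ∀ ε : ℝ, 0 < ε →
      Tendsto
        (fun n : ℕ => (1 / (n : ℝ)) * ∑ j : Fin n,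
          ∫ ω in {ω | ε * Real.sqrt n < |W n j ω * h n j ω|},
            (W n j ω * h n j ω) ^ 2 ∂P)
        atTop (nhds 0) := by
  intro ε hε
  set M := ∫ x, x ^ 4 ∂(gaussianReal 0 1) with hM
  have hlim : Tendsto (fun n : ℕ => (H ^ 4 / ε ^ 2 * M) / (n : ℝ)) atTop (nhds 0) :=
    tendsto_const_div_atTop_nhds_zero_nat _
  refine squeeze_zero' (Eventually.of_forall fun n => ?_) ?_ hlim
  · exact mul_nonneg (by positivity) (Finset.sum_nonneg fun j _ =>
      integral_nonneg fun ω => by positivity)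
  · filter_upwards [eventually_gt_atTop 0] with n hn
    have hn' : (0 : ℝ) < n := by exact_mod_cast hn
    have hs : 0 < Real.sqrt n := Real.sqrt_pos.2 hn'
    have hb := Finset.sum_le_sum (s := Finset.univ) fun (j : Fin n) _ =>
      term_bound P H (ε * Real.sqrt n) (by positivity) (v n j) (hv n j) (W n j) (h n j)
        (hWmeas n j) (hWlaw n j) (hhmeas n j) (hhbdd n j)
    refine (mul_le_mul_of_nonneg_left hb (by positivity)).trans (le_of_eq ?_)
    rw [Finset.sum_const, Finset.card_univ, Fintype.card_fin, nsmul_eq_mul, ← hM, mul_pow,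
      Real.sq_sqrt hn'.le]
    field_simp
end

section
/- Let 0 ≤ v ≤ 1, let W be a real random variable with law gaussianReal 0 v, and let Z be a real random variable with law gaussianReal 0 1. Then for every M ≥ 0: E[W² · 1{|W| > M}] ≤ E[Z² · 1{|Z| > M}]. Moreover, E[Z² · 1{|Z| > M}] tends to 0 as M → ∞. -/
open MeasureTheory ProbabilityTheory Filter

/-- Truncated-second-moment comparison used to verify the Lindeberg condition:
if `W` is centered Gaussian with variance `v ≤ 1` and `Z` is standard Gaussian,
then `E[W² 1{|W| > M}] ≤ E[Z² 1{|Z| > M}]` for all `M ≥ 0`, and the latter tends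
to `0` as `M → ∞`. -/
theorem gaussian_truncated_second_moment_comparison
    {Ω : Type*} [MeasurableSpace Ω] (P : Measure Ω) [IsProbabilityMeasure P]
    (v : NNReal) (hv : v ≤ 1)
    (W Z : Ω → ℝ) (hWmeas : Measurable W) (hZmeas : Measurable Z)
    (hW : Measure.map W P = gaussianReal 0 v)
    (hZ : Measure.map Z P = gaussianReal 0 1) :
    (∀ M : ℝ, 0 ≤ M →
        (∫ ω in {ω | M < |W ω|}, (W ω) ^ 2 ∂P) ≤
          ∫ ω in {ω | M < |Z ω|}, (Z ω) ^ 2 ∂P) ∧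
      Tendsto (fun M : ℝ => ∫ ω in {ω | M < |Z ω|}, (Z ω) ^ 2 ∂P)
        atTop (nhds 0) := by
  have hset : ∀ M : ℝ, MeasurableSet {x : ℝ | M < |x|} := fun M =>
    measurableSet_lt measurable_const measurable_id.abs
  have hint : Integrable (fun ω => (Z ω) ^ 2) P := by
    have h : Integrable (fun x : ℝ => x ^ 2) (Measure.map Z P) := by
      rw [hZ]
      exact (memLp_id_gaussianReal (μ := 0) (v := 1) 2).integrable_sq
    exact h.comp_measurable hZmeas
  have key : ∀ (X : Ω → ℝ), Measurable X → ∀ M : ℝ,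
      ∫ ω in {ω | M < |X ω|}, (X ω) ^ 2 ∂P
        = ∫ x in {x : ℝ | M < |x|}, x ^ 2 ∂(Measure.map X P) := by
    intro X hX M
    rw [setIntegral_map (hset M) (by fun_prop) hX.aemeasurable]
    rfl
  refine ⟨?_, ?_⟩
  · intro M hM
    set c : ℝ := Real.sqrt v with hc
    have hc0 : 0 ≤ c := Real.sqrt_nonneg _
    have hc1 : c ≤ 1 := Real.sqrt_le_one.mpr (by exact_mod_cast hv)
    have hmap : Measure.map W P = Measure.map (fun ω => c * Z ω) P := by
      have h := gaussianReal_map_const_mul (μ := 0) (v := 1) c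
      rw [← hZ, Measure.map_map (by fun_prop) hZmeas] at h
      rw [hW]
      refine Eq.trans ?_ h.symm
      congr 1
      · simp
      · ext
        simp [hc]
    have hle : ∀ ω, |c * Z ω| ≤ |Z ω| := by
      intro ω
      rw [abs_mul, abs_of_nonneg hc0]
      exact mul_le_of_le_one_left (abs_nonneg _) hc1
    rw [key W hWmeas M, hmap, ← key (fun ω => c * Z ω) (by fun_prop) M]
    have hint2 : Integrable (fun ω => (c * Z ω) ^ 2) P := by
      simp only [mul_pow]
      exact hint.const_mul _
    calc ∫ ω in {ω | M < |c * Z ω|}, (c * Z ω) ^ 2 ∂P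
        ≤ ∫ ω in {ω | M < |c * Z ω|}, (Z ω) ^ 2 ∂P :=
          integral_mono hint2.integrableOn hint.integrableOn
            (fun ω => sq_le_sq.mpr (hle ω))
      _ ≤ ∫ ω in {ω | M < |Z ω|}, (Z ω) ^ 2 ∂P :=
          setIntegral_mono_set hint.integrableOn
            (Eventually.of_forall fun ω => sq_nonneg _)
            (Eventually.of_forall fun ω (h : M < |c * Z ω|) => lt_of_lt_of_le h (hle ω))
  · have hm : ∀ M : ℝ, MeasurableSet {ω | M < |Z ω|} := fun M => hZmeas (hset M)
    simp_rw [← fun M => integral_indicator (μ := P) (f := fun ω => (Z ω) ^ 2) (hm M)]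
    rw [show (0 : ℝ) = ∫ _ω, (0 : ℝ) ∂P by simp]
    refine tendsto_integral_filter_of_dominated_convergence (fun ω => (Z ω) ^ 2) ?_ ?_ hint ?_
    · exact Eventually.of_forall fun M =>
        (hint.aestronglyMeasurable.indicator (hm M))
    · refine Eventually.of_forall fun M => Eventually.of_forall fun ω => ?_
      refine (norm_indicator_le_norm_self _ _).trans ?_
      simp
    · refine Eventually.of_forall fun ω => ?_
      refine tendsto_const_nhds.congr' ?_
      filter_upwards [eventually_ge_atTop |Z ω|] with M hM
      simp [Set.indicator, not_lt.mpr hM]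
end
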